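/- There exist a family 𝒞 of cardinality 2^𝔠 consisting of Cantor fields and a family ℬ of cardinality 2^𝔠 consisting of Bernstein fields such that all fields in 𝒞 ∪ ℬ are pairwise incomparable (no ring homomorphism from one into a distinct other) and such that for every K ∈ 𝒞 ∪ ℬ the dimension of ℝ as a vector space over K equals ℵ₀. -/

import Mathlib

noncomputable section

open Set Cardinal

/-- A Cantor set: a nonempty compact subset of ℝ that is totally disconnected
and dense in itself (no isolated points). -/
def IsCantorSet (C : Set ℝ) : Prop :=
  C.Nonempty ∧ IsCompact C ∧ IsTotallyDisconnected C ∧ Preperfect C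

/-- A Bernstein set: neither it nor its complement contains a Cantor set. -/
def IsBernsteinSet (B : Set ℝ) : Prop :=
  (¬ ∃ C ⊆ B, IsCantorSet C) ∧ (¬ ∃ C ⊆ Bᶜ, IsCantorSet C)

/-- A Cantor field: a proper subfield of ℝ containing a Cantor set. -/
def IsCantorField (K : Subfield ℝ) : Prop :=
  K ≠ ⊤ ∧ ∃ C ⊆ (K : Set ℝ), IsCantorSet C

/-- A Bernstein field: a subfield of ℝ which is a Bernstein set. -/
def IsBernsteinField (K : Subfield ℝ) : Prop :=
  IsBernsteinSet (K : Set ℝ)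

/-- A finitely generated group is countable. -/
theorem countable_of_group_fg (G : Type*) [Group G] [Group.FG G] : Countable G := by
  obtain ⟨S, hS, f, hf⟩ := Group.fg_iff_exists_freeGroup_hom_surjective.1 ‹Group.FG G›
  have := hS.countable.to_subtype
  have : Countable (FreeGroup S) := (Quot.mk_surjective (r := FreeGroup.Red.Step)).countable
  exact hf.countable

/-- A finitely generated group has only countably many subgroups of finite index. -/
theorem countable_finiteIndex_subgroup (G : Type*) [Group G] [Group.FG G] :
    {H : Subgroup G | H.FiniteIndex}.Countable := by
  have := countable_of_group_fg G
  refine (Set.countable_range (fun s : Finset G => Subgroup.closure (s : Set G))).mono ?_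
  intro H hH
  have : H.FiniteIndex := hH
  obtain ⟨s, hs⟩ := (Group.fg_iff_subgroup_fg H).1 (Subgroup.fg_of_index_ne_zero H)
  exact ⟨s, hs⟩

/-- Elements of `F` that are fixed by a subgroup `H` of finite index and linearly independent over
the fixed field of `G` number at most the index of `H`. -/
theorem card_le_index_of_linearIndepOn_fixedPoints {G F : Type*} [Group G] [Field F]
    [MulSemiringAction G F] (H : Subgroup G) [H.FiniteIndex] (s : Finset F)
    (hfix : ∀ z ∈ s, ∀ h ∈ H, h • z = z)
    (hs : LinearIndepOn (FixedPoints.subfield G F) id (s : Set F)) : s.card ≤ H.index := by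
  have hli := FixedPoints.linearIndependent_smul_of_linearIndependent G F hs
  let Φ : (G ⧸ H → F) →ₗ[F] (G → F) := LinearMap.funLeft F F (QuotientGroup.mk : G → G ⧸ H)
  let u : s → G ⧸ H → F := fun z q => Quotient.liftOn' q (fun g => g • (z : F)) (by
    intro a b hab
    have h := hfix z z.2 _ (QuotientGroup.leftRel_apply.1 hab)
    change a • (z : F) = b • (z : F)
    rw [mul_smul, inv_smul_eq_iff] at h
    exact h.symm)
  have hu : LinearIndependent F u := LinearIndependent.of_comp Φ hli
  have := hu.fintype_card_le_finrank
  have := Fintype.ofFinite (G ⧸ H)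
  rw [Subgroup.index_eq_card, Nat.card_eq_fintype_card]
  simpa using hu.fintype_card_le_finrank

/-- If a finitely generated group acts on a field with finite orbits, then every family that is
linearly independent over the fixed field is countable. -/
theorem countable_of_linearIndependent_fixedPoints {G F ι : Type*} [Group G] [Group.FG G] [Field F]
    [MulSemiringAction G F] (horb : ∀ z : F, (MulAction.orbit G z).Finite) (b : ι → F)
    (hb : LinearIndependent (FixedPoints.subfield G F) b) : Countable ι := by
  classical
  have hfi : ∀ z : F, (MulAction.stabilizer G z).FiniteIndex := fun z => by
    have : Finite (MulAction.orbit G z) := (horb z).to_subtype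
    have : Finite (G ⧸ MulAction.stabilizer G z) :=
      Finite.of_equiv _ (MulAction.orbitEquivQuotientStabilizer G z)
    exact Subgroup.finiteIndex_of_finite_quotient
  have hcov : (⋃ H ∈ {H : Subgroup G | H.FiniteIndex},
      {i | MulAction.stabilizer G (b i) = H}) = Set.univ := by
    ext i
    simpa using hfi (b i)
  rw [← Set.countable_univ_iff, ← hcov]
  refine (countable_finiteIndex_subgroup G).biUnion fun H hH => Set.Finite.countable ?_
  have : H.FiniteIndex := hH
  by_contra hinf
  obtain ⟨s, hsub, hcard⟩ := Set.Infinite.exists_subset_card_eq hinf (H.index + 1)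
  have hle := card_le_index_of_linearIndepOn_fixedPoints H (s.image b) (by
    intro z hz h hh
    obtain ⟨i, hi, rfl⟩ := Finset.mem_image.1 hz
    have : MulAction.stabilizer G (b i) = H := hsub hi
    rw [← this] at hh
    exact hh) (by
    have := hb.linearIndepOn_id
    exact this.mono (by simp))
  rw [Finset.card_image_of_injective s hb.injective] at hle
  omega

/-- `K` is maximal among the subfields of `ℝ` omitting `τ`, while containing the cube of `τ`. -/
structure IsMaximalOmitting (K : Subfield ℝ) (τ : ℝ) : Prop where
  notMem : τ ∉ K
  cube_mem : τ ^ 3 ∈ K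
  le_of_le : ∀ L : Subfield ℝ, K ≤ L → τ ∉ L → L ≤ K

theorem exists_isMaximalOmitting (K₀ : Subfield ℝ) (τ : ℝ) (h : τ ∉ K₀) (h3 : τ ^ 3 ∈ K₀) :
    ∃ K : Subfield ℝ, K₀ ≤ K ∧ IsMaximalOmitting K τ := by
  obtain ⟨K, hK, hmax⟩ := zorn_le_nonempty₀ {K : Subfield ℝ | τ ∉ K} (by
    intro c hc hchain y hy
    refine ⟨sSup c, ?_, fun z hz => le_sSup hz⟩
    intro hmem
    obtain ⟨s, hs, hτ⟩ := (Subfield.mem_sSup_of_directedOn ⟨y, hy⟩ hchain.directedOn).1 hmem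
    exact hc hs hτ) K₀ h
  exact ⟨K, hK, hmax.prop, hK h3, fun L hL hτ => hmax.le_of_ge hτ hL⟩

/-- The field obtained by adjoining a square root `r` of an element of `K`. -/
def adjoinSqrt (K : Subfield ℝ) (r : ℝ) (hr : r ∉ K) (hr2 : r ^ 2 ∈ K) : Subfield ℝ where
  carrier := {z | ∃ x ∈ K, ∃ y ∈ K, z = x + y * r}
  mul_mem' := by
    rintro _ _ ⟨x, hx, y, hy, rfl⟩ ⟨x', hx', y', hy', rfl⟩
    exact ⟨x * x' + y * y' * r ^ 2, add_mem (mul_mem hx hx') (mul_mem (mul_mem hy hy') hr2),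
      x * y' + y * x', add_mem (mul_mem hx hy') (mul_mem hy hx'), by ring⟩
  one_mem' := ⟨1, one_mem K, 0, zero_mem K, by ring⟩
  add_mem' := by
    rintro _ _ ⟨x, hx, y, hy, rfl⟩ ⟨x', hx', y', hy', rfl⟩
    exact ⟨x + x', add_mem hx hx', y + y', add_mem hy hy', by ring⟩
  zero_mem' := ⟨0, zero_mem K, 0, zero_mem K, by ring⟩
  neg_mem' := by
    rintro _ ⟨x, hx, y, hy, rfl⟩
    exact ⟨-x, neg_mem hx, -y, neg_mem hy, by ring⟩
  inv_mem' := by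
    rintro _ ⟨x, hx, y, hy, rfl⟩
    by_cases hy0 : y = 0
    · exact ⟨x⁻¹, inv_mem hx, 0, zero_mem K, by simp [hy0]⟩
    have h1 : x + y * r ≠ 0 := fun h => hr (by
      have : r = -x / y := by field_simp; linarith
      rw [this]; exact div_mem (neg_mem hx) hy)
    have h2 : x - y * r ≠ 0 := fun h => hr (by
      have : r = x / y := by field_simp; linarith
      rw [this]; exact div_mem hx hy)
    have hD : x ^ 2 - y ^ 2 * r ^ 2 ∈ K := sub_mem (pow_mem hx 2) (mul_mem (pow_mem hy 2) hr2)
    have h3 : x ^ 2 - y ^ 2 * r ^ 2 = (x + y * r) * (x - y * r) := by ring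
    refine ⟨x / (x ^ 2 - y ^ 2 * r ^ 2), div_mem hx hD, -y / (x ^ 2 - y ^ 2 * r ^ 2),
      div_mem (neg_mem hy) hD, ?_⟩
    rw [h3]
    field_simp
    ring

theorem le_adjoinSqrt (K : Subfield ℝ) (r : ℝ) (hr : r ∉ K) (hr2 : r ^ 2 ∈ K) :
    K ≤ adjoinSqrt K r hr hr2 := fun x hx => ⟨x, hx, 0, zero_mem K, by ring⟩

theorem mem_adjoinSqrt (K : Subfield ℝ) (r : ℝ) (hr : r ∉ K) (hr2 : r ^ 2 ∈ K) :
    r ∈ adjoinSqrt K r hr hr2 := ⟨0, zero_mem K, 1, one_mem K, by ring⟩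

namespace IsMaximalOmitting

variable {K : Subfield ℝ} {τ : ℝ}

/-- Such a field is closed under square roots of nonnegative elements. -/
theorem sqrt_mem (h : IsMaximalOmitting K τ) {a : ℝ} (ha : a ∈ K) (ha0 : 0 ≤ a) : √a ∈ K := by
  by_contra hr
  have hr2 : √a ^ 2 ∈ K := by rwa [Real.sq_sqrt ha0]
  have hτ : τ ∈ adjoinSqrt K (√a) hr hr2 := by
    by_contra hτ
    exact hr (h.le_of_le _ (le_adjoinSqrt K _ hr hr2) hτ (mem_adjoinSqrt K _ hr hr2))
  obtain ⟨x, hx, y, hy, hxy⟩ := hτ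
  by_cases hc : (3 * x ^ 2 + y ^ 2 * √a ^ 2) * y = 0
  · have hy0 : y = 0 := by
      rcases mul_eq_zero.1 hc with h0 | h0
      · have ha' : 0 < √a := lt_of_le_of_ne (Real.sqrt_nonneg a) fun h => hr (h ▸ zero_mem K)
        by_contra hy0
        have : 0 < y ^ 2 * √a ^ 2 := by positivity
        nlinarith [sq_nonneg x]
      · exact h0
    apply h.notMem
    rw [hxy, hy0]
    simpa using hx
  · apply hr
    have hD : (3 * x ^ 2 + y ^ 2 * √a ^ 2) * y ∈ K :=
      mul_mem (add_mem (mul_mem (by exact_mod_cast natCast_mem K 3) (pow_mem hx 2))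
        (mul_mem (pow_mem hy 2) hr2)) hy
    have hN : τ ^ 3 - x ^ 3 - 3 * x * y ^ 2 * √a ^ 2 ∈ K :=
      sub_mem (sub_mem h.cube_mem (pow_mem hx 3))
        (mul_mem (mul_mem (mul_mem (by exact_mod_cast natCast_mem K 3) hx) (pow_mem hy 2)) hr2)
    have : √a = (τ ^ 3 - x ^ 3 - 3 * x * y ^ 2 * √a ^ 2) /
        ((3 * x ^ 2 + y ^ 2 * √a ^ 2) * y) := by
      rw [eq_div_iff hc, hxy]
      ring
    rw [this]
    exact div_mem hN hD

open IntermediateField in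
theorem isAlgebraic (h : IsMaximalOmitting K τ) : Algebra.IsAlgebraic K ℝ := by
  refine ⟨fun s => ?_⟩
  by_contra hs
  have hs : Transcendental K s := hs
  have hτ : τ ∈ K⟮s⟯ := by
    by_contra hτ
    have hle := h.le_of_le (K⟮s⟯).toSubfield (fun x hx => (K⟮s⟯).algebraMap_mem ⟨x, hx⟩) hτ
    exact hs (isAlgebraic_algebraMap (⟨s, hle (mem_adjoin_simple_self K s)⟩ : K))
  let e := RatFunc.algEquivOfTranscendental s hs
  have halg : IsAlgebraic K (⟨τ, hτ⟩ : K⟮s⟯) := by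
    have h3 : IsAlgebraic K ((⟨τ, hτ⟩ : K⟮s⟯) ^ 3) :=
      isAlgebraic_algebraMap (⟨τ ^ 3, h.cube_mem⟩ : K)
    exact h3.of_pow (by norm_num)
  have halg' : IsAlgebraic K (e.symm ⟨τ, hτ⟩) := halg.algHom e.symm.toAlgHom
  by_cases hc : ∃ c, e.symm ⟨τ, hτ⟩ = RatFunc.C c
  · obtain ⟨c, hc⟩ := hc
    have h1 : (⟨τ, hτ⟩ : K⟮s⟯) = algebraMap K K⟮s⟯ c := by
      rw [← e.commutes c, ← e.symm_apply_eq, hc]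
      rfl
    have h2 : τ = c := congrArg Subtype.val h1
    exact h.notMem (h2 ▸ c.2)
  · exact RatFunc.transcendental_of_ne_C _ hc halg'

theorem aleph0_le_rank (h : IsMaximalOmitting K τ) : ℵ₀ ≤ Module.rank K ℝ := by
  by_contra! hlt
  have hfin : FiniteDimensional K ℝ := Module.rank_lt_aleph0_iff.1 hlt
  have habs : |τ| ^ 3 ∈ K := by
    rw [← abs_pow]
    rcases abs_choice (τ ^ 3) with h' | h' <;> rw [h']
    · exact h.cube_mem
    · exact neg_mem h.cube_mem
  set n := Module.finrank K ℝ with hn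
  have hirr := X_pow_sub_C_irreducible_of_prime_pow Nat.prime_three (by norm_num) n
    (a := (⟨|τ| ^ 3, habs⟩ : K)) (by
      rintro ⟨b, hb⟩ hb3
      have hb3 : b ^ 3 = |τ| ^ 3 := congrArg Subtype.val hb3
      have hb' : b = |τ| := (Odd.strictMono_pow (by decide : Odd 3)).injective hb3
      apply h.notMem
      rcases abs_choice τ with h' | h' <;> rw [h'] at hb'
      · exact hb' ▸ hb
      · have := neg_mem hb
        rwa [hb', neg_neg] at this)
  obtain ⟨r, hr⟩ : ∃ r : ℝ, r ^ (3 ^ n) = |τ| ^ 3 :=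
    ⟨(|τ| ^ 3) ^ (((3 ^ n : ℕ) : ℝ)⁻¹), Real.rpow_inv_natCast_pow (by positivity) (by positivity)⟩
  have hmin := minpoly.eq_of_irreducible_of_monic hirr (x := r)
    (by
      rw [map_sub, map_pow, Polynomial.aeval_X, Polynomial.aeval_C, hr]
      exact sub_self _) (Polynomial.monic_X_pow_sub_C _ (by positivity))
  have hdeg := minpoly.natDegree_le (A := K) r
  rw [← hmin, Polynomial.natDegree_X_pow_sub_C, ← hn] at hdeg
  exact absurd hdeg (not_le.2 (Nat.lt_pow_self (by norm_num)))

theorem rank_le_aleph0 (h : IsMaximalOmitting K τ) : Module.rank K ℝ ≤ ℵ₀ := by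
  have halg := h.isAlgebraic
  have hCalg : Algebra.IsAlgebraic K ℂ := Algebra.IsAlgebraic.trans K ℝ ℂ
  have : IsAlgClosure K ℂ := ⟨inferInstance, hCalg⟩
  have hcoe : ∀ x : K, algebraMap K ℂ x = ((x : ℝ) : ℂ) := fun x => rfl
  obtain ⟨σ, hσ⟩ : ∃ σ : Gal(ℂ/K), σ τ ≠ τ := by
    by_contra! hσ
    obtain ⟨x, hx⟩ := (InfiniteGalois.mem_range_algebraMap_iff_fixed (k := K) (τ : ℂ)).2 hσ
    rw [hcoe] at hx
    exact h.notMem (Complex.ofReal_injective hx ▸ x.2)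
  let c : Gal(ℂ/K) := Complex.conjAe.restrictScalars K
  classical
  let Γ : Subgroup Gal(ℂ/K) := Subgroup.closure {σ, c}
  have hΓ : Group.FG Γ := (Group.fg_iff_subgroup_fg Γ).2 ⟨{σ, c}, by simp [Γ]⟩
  have hfixed : ∀ z : ℂ, z ∈ FixedPoints.subfield Γ ℂ → ∃ x : K, algebraMap K ℂ x = z := by
    intro z hz
    have hzσ : σ z = z := hz ⟨σ, Subgroup.subset_closure (by simp)⟩
    have hzc : c z = z := hz ⟨c, Subgroup.subset_closure (by simp)⟩
    obtain ⟨x, rfl⟩ := Complex.conj_eq_iff_real.1 hzc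
    let L : Subfield ℝ := (RingHom.eqLocusField (σ : ℂ →+* ℂ) (RingHom.id ℂ)).comap Complex.ofRealHom
    have hL : L ≤ K := h.le_of_le L (fun y hy => σ.commutes ⟨y, hy⟩) hσ
    exact ⟨⟨x, hL hzσ⟩, rfl⟩
  have horb : ∀ z : ℂ, (MulAction.orbit Γ z).Finite := by
    intro z
    have hz := (hCalg.isAlgebraic z).isIntegral
    refine ((minpoly K z).rootSet_finite ℂ).subset ?_
    rintro _ ⟨g, rfl⟩
    rw [Polynomial.mem_rootSet]
    refine ⟨minpoly.ne_zero hz, ?_⟩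
    change Polynomial.aeval ((g : Gal(ℂ/K)) z) _ = 0
    rw [Polynomial.aeval_algHom_apply, minpoly.aeval, map_zero]
  let b := Module.Basis.ofVectorSpace K ℝ
  let i : K → FixedPoints.subfield Γ ℂ := fun x =>
    ⟨algebraMap K ℂ x, fun g => (g : Gal(ℂ/K)).commutes x⟩
  have hli : LinearIndependent (FixedPoints.subfield Γ ℂ) (Complex.ofRealHom.toAddMonoidHom ∘ b) := by
    refine b.linearIndependent.map_of_surjective_injective i _ ?_ ?_ ?_
    · rintro ⟨z, hz⟩
      obtain ⟨x, rfl⟩ := hfixed z hz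
      exact ⟨x, rfl⟩
    · intro x hx
      exact Complex.ofReal_injective hx
    · intro r m
      exact Complex.ofReal_mul _ _
  have hcount := countable_of_linearIndependent_fixedPoints horb _ hli
  rw [← b.mk_eq_rank'']
  exact Cardinal.mk_le_aleph0_iff.2 hcount

theorem rank_eq_aleph0 (h : IsMaximalOmitting K τ) : Module.rank K ℝ = ℵ₀ :=
  h.rank_le_aleph0.antisymm h.aleph0_le_rank

end IsMaximalOmitting

/-- A ring homomorphism between subfields of `ℝ` whose domain is closed under square roots of
nonnegative elements is an inclusion. -/
theorem Subfield.le_of_ringHom {K L : Subfield ℝ} (hK : ∀ a ∈ K, 0 ≤ a → √a ∈ K) (φ : K →+* L) :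
    K ≤ L := by
  let ψ : K →+* ℝ := L.subtype.comp φ
  have hmono : Monotone ψ := by
    intro x y hxy
    have h0 : (0 : ℝ) ≤ y - x := sub_nonneg.2 hxy
    let r : K := ⟨√(y - x), hK _ (sub_mem y.2 x.2) h0⟩
    have hr : y - x = r * r := Subtype.ext (Real.mul_self_sqrt h0).symm
    have : ψ y - ψ x = ψ r * ψ r := by rw [← map_sub, hr, map_mul]
    nlinarith [mul_self_nonneg (ψ r)]
  have heq : (⟨ψ, hmono⟩ : K →+*o ℝ) = ⟨K.subtype, fun _ _ h => h⟩ := Subsingleton.elim _ _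
  intro x hx
  have : ψ ⟨x, hx⟩ = x := congrArg (fun f : K →+*o ℝ => f ⟨x, hx⟩) heq
  exact this ▸ (φ ⟨x, hx⟩).2

/-- A transcendental element does not lie in the field generated by its cube. -/
theorem Transcendental.notMem_adjoin_cube {F E : Type*} [Field F] [Field E] [Algebra F E] {x : E}
    (hx : Transcendental F x) : x ∉ IntermediateField.adjoin F {x ^ 3} := by
  intro hmem
  obtain ⟨p, q, hpq⟩ := (IntermediateField.mem_adjoin_simple_iff F x).1 hmem
  have hq : Polynomial.aeval (x ^ 3) q ≠ 0 := fun h => hx (by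
    rw [h, div_zero] at hpq
    exact hpq ▸ isAlgebraic_zero)
  have hq0 : q ≠ 0 := fun h => hq (by simp [h])
  have hker : Polynomial.X * Polynomial.expand F 3 q = Polynomial.expand F 3 p := by
    rw [← sub_eq_zero]
    refine (transcendental_iff.1 hx) _ ?_
    rw [map_sub, map_mul, Polynomial.aeval_X, Polynomial.expand_aeval, Polynomial.expand_aeval,
      sub_eq_zero, ← eq_div_iff hq]
    exact hpq
  have hdeg := congrArg Polynomial.natDegree hker
  rw [Polynomial.natDegree_X_mul ((Polynomial.expand_ne_zero (by norm_num)).2 hq0),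
    Polynomial.natDegree_expand, Polynomial.natDegree_expand] at hdeg
  omega

/-- Algebraic independence is preserved by adding multiples of one member to the others. -/
theorem AlgebraicIndependent.option_add_smul {R A ι : Type*} [CommRing R] [CommRing A] [Algebra R A]
    {τ : A} {t : ι → A} (h : AlgebraicIndependent R (fun o : Option ι => o.elim τ t)) (c : ι → R) :
    AlgebraicIndependent R (fun o : Option ι => o.elim τ (fun i => t i + c i • τ)) := by
  let f : Option ι → MvPolynomial (Option ι) R := fun o => o.elim (MvPolynomial.X none)
    fun i => MvPolynomial.X (some i) + c i • MvPolynomial.X none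
  let g : Option ι → MvPolynomial (Option ι) R := fun o => o.elim (MvPolynomial.X none)
    fun i => MvPolynomial.X (some i) - c i • MvPolynomial.X none
  have hgf : (MvPolynomial.aeval g).comp (MvPolynomial.aeval f) = AlgHom.id R _ := by
    refine MvPolynomial.algHom_ext fun o => ?_
    cases o <;> simp [f, g]
  have hf : AlgebraicIndependent R f := by
    rw [algebraicIndependent_iff_injective_aeval]
    intro p q hpq
    have := congrArg (MvPolynomial.aeval g) hpq
    rw [← AlgHom.comp_apply, ← AlgHom.comp_apply, hgf] at this
    exact this
  have heq : (fun o : Option ι => o.elim τ (fun i => t i + c i • τ)) =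
      fun o => MvPolynomial.aeval (fun o : Option ι => o.elim τ t) (f o) := by
    funext o
    cases o <;> simp [f]
  rw [heq]
  exact h.aeval_of_algebraicIndependent hf

theorem exists_isMaximalOmitting_add_mem {ι : Type*} {τ : ℝ} {t : ι → ℝ}
    (h : AlgebraicIndependent ℚ (fun o : Option ι => o.elim τ t)) (c : ι → ℚ) :
    ∃ K : Subfield ℝ, IsMaximalOmitting K τ ∧ ∀ i, t i + c i * τ ∈ K := by
  let M := IntermediateField.adjoin ℚ (Set.range fun i => t i + c i • τ)
  have hτ : Transcendental M τ := by
    rw [IntermediateField.transcendental_adjoin_iff]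
    exact (AlgebraicIndependent.option_iff.1 (h.option_add_smul c)).2
  obtain ⟨K, hK, hmax⟩ := exists_isMaximalOmitting (IntermediateField.adjoin M {τ ^ 3}).toSubfield τ
    hτ.notMem_adjoin_cube (IntermediateField.mem_adjoin_simple_self M (τ ^ 3))
  refine ⟨K, hmax, fun i => hK ?_⟩
  have hi : t i + c i • τ ∈ M := IntermediateField.subset_adjoin _ _ ⟨i, rfl⟩
  have := (IntermediateField.adjoin M {τ ^ 3}).algebraMap_mem ⟨_, hi⟩
  rw [← Rat.smul_def]
  exact this

/-- From an algebraically independent family `τ, t` we get for each set `S` of indices a field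
omitting `τ` that contains `t i` for `i ∉ S` and `t i + τ` for `i ∈ S`. -/
theorem exists_family_isMaximalOmitting {ι : Type*} {τ : ℝ} {t : ι → ℝ}
    (h : AlgebraicIndependent ℚ (fun o : Option ι => o.elim τ t)) :
    ∃ K : Set ι → Subfield ℝ, (∀ S, IsMaximalOmitting (K S) τ) ∧
      (∀ S, ∀ i, t i ∈ K S ↔ i ∉ S) ∧ ∀ S S', K S ≤ K S' → S = S' := by
  choose K hK hmem using fun S : Set ι => exists_isMaximalOmitting_add_mem h (S.indicator 1)
  have hin : ∀ S, ∀ i ∈ S, t i + τ ∈ K S := fun S i hi => by simpa [hi] using hmem S i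
  have hout : ∀ S, ∀ i ∉ S, t i ∈ K S := fun S i hi => by simpa [hi] using hmem S i
  have hsep : ∀ S i, ¬ (t i ∈ K S ∧ t i + τ ∈ K S) := fun S i hi =>
    (hK S).notMem (by simpa using sub_mem hi.2 hi.1)
  refine ⟨K, hK, fun S i => ⟨fun hi hiS => hsep S i ⟨hi, hin S i hiS⟩, hout S i⟩, ?_⟩
  intro S S' hle
  ext i
  refine ⟨fun hi => ?_, fun hi => ?_⟩
  · by_contra hi'
    exact hsep S' i ⟨hout S' i hi', hle (hin S i hi)⟩
  · by_contra hi'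
    exact hsep S' i ⟨hle (hout S i hi'), hin S' i hi⟩

namespace MvPolynomial

variable {σ : Type*}

theorem exists_abs_aeval_sub_aeval_le {u : ℕ → σ → ℝ} {x : σ → ℝ} {ε : ℕ → ℝ}
    (hε : ∀ n, ε n ≤ 1) (h : ∀ n i, |u n i - x i| ≤ ε n) (p : MvPolynomial σ ℚ) :
    ∃ c : ℝ, 0 ≤ c ∧ ∀ n, |aeval (u n) p - aeval x p| ≤ c * ε n := by
  induction p using MvPolynomial.induction_on with
  | C a => exact ⟨0, le_rfl, fun n => by simp⟩
  | add p q hp hq =>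
    obtain ⟨c, hc0, hc⟩ := hp
    obtain ⟨d, hd0, hd⟩ := hq
    refine ⟨c + d, by positivity, fun n => ?_⟩
    rw [map_add, map_add, add_sub_add_comm, add_mul]
    exact (abs_add_le _ _).trans (add_le_add (hc n) (hd n))
  | mul_X p i hp =>
    obtain ⟨c, hc0, hc⟩ := hp
    refine ⟨c * (|x i| + 1) + |aeval x p|, by positivity, fun n => ?_⟩
    have hε0 : 0 ≤ ε n := (abs_nonneg _).trans (h n i)
    have hui : |u n i| ≤ |x i| + 1 := by
      have := abs_add_le (u n i - x i) (x i)
      rw [sub_add_cancel] at this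
      linarith [h n i, hε n]
    have hsplit : aeval (u n) (p * X i) - aeval x (p * X i) =
        (aeval (u n) p - aeval x p) * u n i + aeval x p * (u n i - x i) := by
      simp only [map_mul, aeval_X]
      ring
    rw [hsplit]
    refine (abs_add_le _ _).trans ?_
    rw [abs_mul, abs_mul]
    calc _ ≤ (c * ε n) * (|x i| + 1) + |aeval x p| * ε n := by
          gcongr
          exacts [hc n, h n i]
      _ = _ := by ring

theorem exists_mul_aeval_mul_pow_eq_intCast {u : ℕ → σ → ℝ} {D : ℕ → ℕ}
    (h : ∀ n i, ∃ m : ℤ, u n i * D n = m) (p : MvPolynomial σ ℚ) :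
    ∃ N d : ℕ, N ≠ 0 ∧ ∀ n, ∃ m : ℤ, N * aeval (u n) p * (D n : ℝ) ^ d = m := by
  induction p using MvPolynomial.induction_on with
  | C a =>
    refine ⟨a.den, 0, a.den_nz, fun n => ⟨a.num, ?_⟩⟩
    rw [pow_zero, mul_one, algHom_C, eq_ratCast]
    exact_mod_cast congrArg (Rat.cast (K := ℝ)) (Rat.den_mul_eq_num a)
  | add p q hp hq =>
    obtain ⟨N, d, hN, hp⟩ := hp
    obtain ⟨N', d', hN', hq⟩ := hq
    refine ⟨N * N', d + d', mul_ne_zero hN hN', fun n => ?_⟩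
    obtain ⟨a, ha⟩ := hp n
    obtain ⟨b, hb⟩ := hq n
    refine ⟨a * N' * D n ^ d' + b * N * D n ^ d, ?_⟩
    push_cast
    rw [← ha, ← hb, map_add]
    ring
  | mul_X p i hp =>
    obtain ⟨N, d, hN, hp⟩ := hp
    refine ⟨N, d + 1, hN, fun n => ?_⟩
    obtain ⟨a, ha⟩ := hp n
    obtain ⟨b, hb⟩ := h n i
    refine ⟨a * b, ?_⟩
    push_cast
    rw [← ha, ← hb, map_mul, aeval_X]
    ring

/-- A Liouville-type estimate: good simultaneous rational approximations of a zero of a polynomial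
are eventually zeros themselves. -/
theorem eventually_aeval_eq_zero {u : ℕ → σ → ℝ} {x : σ → ℝ} {D : ℕ → ℕ} (hD : ∀ n, 2 ≤ D n)
    (hDu : ∀ n i, ∃ m : ℤ, u n i * D n = m)
    (happrox : ∀ n i, |u n i - x i| ≤ 1 / (D n : ℝ) ^ n)
    {p : MvPolynomial σ ℚ} (hp : aeval x p = 0) : ∀ᶠ n in Filter.atTop, aeval (u n) p = 0 := by
  have hD1 : ∀ n, (1 : ℝ) ≤ D n := fun n => by exact_mod_cast one_le_two.trans (hD n)
  obtain ⟨c, hc0, hc⟩ := exists_abs_aeval_sub_aeval_le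
    (fun n => by rw [one_div]; exact inv_le_one_of_one_le₀ (one_le_pow₀ (hD1 n))) happrox p
  obtain ⟨N, d, hN, hm⟩ := exists_mul_aeval_mul_pow_eq_intCast hDu p
  obtain ⟨k, hk⟩ := pow_unbounded_of_one_lt (N * c) (one_lt_two (α := ℝ))
  filter_upwards [Filter.eventually_ge_atTop (d + k)] with n hn
  obtain ⟨m, hm⟩ := hm n
  have hDpos : (0 : ℝ) < D n := one_pos.trans_le (hD1 n)
  have hlt : |(m : ℝ)| < 1 := by
    have hcn := hc n
    rw [hp, sub_zero] at hcn
    rw [← hm, abs_mul, abs_mul, Nat.abs_cast, abs_of_pos (pow_pos hDpos d)]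
    calc (N : ℝ) * |aeval (u n) p| * (D n : ℝ) ^ d
        ≤ N * (c * (1 / (D n : ℝ) ^ n)) * (D n : ℝ) ^ d := by gcongr
      _ = N * c * ((D n : ℝ) ^ d / (D n : ℝ) ^ n) := by ring
      _ ≤ N * c * (1 / (D n : ℝ) ^ k) := by
        refine mul_le_mul_of_nonneg_left ?_ (by positivity)
        rw [div_le_div_iff₀ (by positivity) (by positivity), one_mul, ← pow_add]
        exact pow_le_pow_right₀ (hD1 n) hn
      _ ≤ N * c * (1 / (2 : ℝ) ^ k) := by
        gcongr
        exact_mod_cast hD n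
      _ < 1 := by
        rw [mul_one_div, div_lt_one (by positivity)]
        exact hk
  have hm0 : m = 0 := by
    rw [← Int.cast_abs] at hlt
    exact Int.abs_lt_one_iff.1 (by exact_mod_cast hlt)
  rw [hm0, Int.cast_zero] at hm
  have hN' : (N : ℝ) ≠ 0 := by exact_mod_cast hN
  simpa [hN', hDpos.ne'] using hm

/-- First-order expansion of a polynomial in one variable, with continuous difference quotient. -/
theorem exists_continuous_aeval_update [DecidableEq σ] (p : MvPolynomial σ ℚ) (i : σ) :
    ∃ q : (σ → ℝ) × ℝ → ℝ, Continuous q ∧ (∀ y, q (y, 0) = aeval y (pderiv i p)) ∧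
      ∀ y δ, aeval (Function.update y i (y i + δ)) p = aeval y p + δ * q (y, δ) := by
  induction p using MvPolynomial.induction_on with
  | C a => exact ⟨fun _ => 0, continuous_const, by simp, by simp⟩
  | add p q hp hq =>
    obtain ⟨f, hf, hf0, hfδ⟩ := hp
    obtain ⟨g, hg, hg0, hgδ⟩ := hq
    refine ⟨fun z => f z + g z, hf.add hg, by simp [hf0, hg0], fun y δ => ?_⟩
    rw [map_add, map_add, hfδ, hgδ]
    ring
  | mul_X p j hp =>
    obtain ⟨f, hf, hf0, hfδ⟩ := hp
    have hcont : Continuous fun y : σ → ℝ => aeval y p := by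
      simpa only [eval_map, ← aeval_def] using MvPolynomial.continuous_eval (p.map (algebraMap ℚ ℝ))
    by_cases hij : j = i
    · subst hij
      refine ⟨fun z => f z * (z.1 j + z.2) + aeval z.1 p, by fun_prop, fun y => ?_, fun y δ => ?_⟩
      · simp [hf0, mul_comm, add_comm]
      · simp only [map_mul, hfδ, aeval_X, Function.update_self]
        ring
    · refine ⟨fun z => f z * z.1 j, by fun_prop, fun y => ?_, fun y δ => ?_⟩
      · simp [hf0, pderiv_X_of_ne hij, mul_comm]
      · simp only [map_mul, hfδ, aeval_X, Function.update_of_ne hij]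
        ring

theorem eq_C_of_pderiv_eq_zero {R : Type*} [CommRing R] [IsDomain R] [CharZero R]
    {p : MvPolynomial σ R} (h : ∀ i, pderiv i p = 0) : p = C (coeff 0 p) := by
  classical
  ext m
  rw [coeff_C]
  split_ifs with hm
  · rw [hm]
  obtain ⟨i, hi⟩ : ∃ i, m i ≠ 0 := by
    by_contra! hm'
    exact hm (Finsupp.ext fun i => (hm' i).symm)
  have hcoeff := coeff_pderiv p (m - Finsupp.single i 1) (i := i)
  rw [h i, coeff_zero, tsub_add_cancel_of_le
    (Finsupp.single_le_iff.2 (Nat.one_le_iff_ne_zero.2 hi)), zero_eq_mul] at hcoeff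
  exact hcoeff.resolve_right (Nat.cast_add_one_ne_zero _)

theorem totalDegree_pderiv_le {R : Type*} [CommSemiring R] (p : MvPolynomial σ R) (i : σ) :
    (pderiv i p).totalDegree ≤ p.totalDegree - 1 := by
  classical
  refine Finset.sup_le fun m hm => ?_
  rw [mem_support_iff, coeff_pderiv] at hm
  have := le_totalDegree (mem_support_iff.2 (left_ne_zero_of_mul hm))
  rw [Finsupp.sum_add_index' (fun _ => rfl) (fun _ _ _ => rfl), Finsupp.sum_single_index rfl] at this
  omega

/-- If the polynomials vanishing at `x` are stable under partial derivatives, then `x` is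
algebraically independent. -/
theorem algebraicIndependent_of_aeval_pderiv_eq_zero {x : σ → ℝ}
    (h : ∀ (p : MvPolynomial σ ℚ) (i : σ), aeval x p = 0 → aeval x (pderiv i p) = 0) :
    AlgebraicIndependent ℚ x := by
  have key : ∀ (n : ℕ) (p : MvPolynomial σ ℚ), p.totalDegree ≤ n → aeval x p = 0 → p = 0 := by
    intro n
    induction n with
    | zero =>
      intro p hp hx
      rw [totalDegree_eq_zero_iff_eq_C.1 (Nat.le_zero.1 hp)] at hx ⊢
      simpa using hx
    | succ n ih =>
      intro p hp hx
      have hC := eq_C_of_pderiv_eq_zero fun i =>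
        ih (pderiv i p) ((totalDegree_pderiv_le p i).trans (by omega)) (h p i hx)
      rw [hC] at hx ⊢
      simpa using hx
  rw [algebraicIndependent_iff]
  exact fun p hp => key _ p le_rfl hp

end MvPolynomial

open scoped Nat in
/-- The partial sum up to `n` of the binary series with digits at the factorials of members
of `S`. -/
def factorialPartialSum (S : Set ℕ) (n : ℕ) : ℝ :=
  ∑ i ∈ Finset.range (n + 1), S.indicator (fun i => 1 / 2 ^ i !) i

open scoped Nat in
/-- The sum of `2⁻ⁿ` over all factorials `n` of members of `S`. -/
def factorialSum (S : Set ℕ) : ℝ :=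
  ∑' i : ℕ, S.indicator (fun i => 1 / 2 ^ i !) i

open scoped Nat in
theorem abs_factorialPartialSum_sub_le (S : Set ℕ) (n : ℕ) :
    |factorialPartialSum S n - factorialSum S| ≤ 1 / (((2 ^ n ! : ℕ)) : ℝ) ^ n := by
  have hsum := LiouvilleNumber.summable one_lt_two
  have hS : Summable (S.indicator fun i : ℕ => (1 : ℝ) / 2 ^ i !) := hsum.indicator S
  have hsplit : factorialPartialSum S n - factorialSum S =
      -∑' i, S.indicator (fun i : ℕ => (1 : ℝ) / 2 ^ i !) (i + (n + 1)) := by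
    rw [factorialPartialSum, factorialSum, ← hS.sum_add_tsum_nat_add (n + 1)]
    ring
  have hnn : ∀ i, 0 ≤ S.indicator (fun i : ℕ => (1 : ℝ) / 2 ^ i !) (i + (n + 1)) := fun i =>
    Set.indicator_nonneg (fun _ _ => by positivity) _
  rw [hsplit, abs_neg, abs_of_nonneg (tsum_nonneg hnn)]
  push_cast
  refine le_trans ?_ (LiouvilleNumber.remainder_lt n le_rfl).le
  exact ((summable_nat_add_iff (n + 1)).2 hS).tsum_le_tsum
    (fun i => Set.indicator_le_self' (fun _ _ => by positivity) _)
    (LiouvilleNumber.remainder_summable one_lt_two n)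

open scoped Nat in
theorem exists_factorialPartialSum_mul_eq_intCast (S : Set ℕ) (n : ℕ) :
    ∃ m : ℤ, factorialPartialSum S n * (2 ^ n ! : ℕ) = m := by
  classical
  refine ⟨∑ i ∈ Finset.range (n + 1), if i ∈ S then 2 ^ (Nat.factorial n - Nat.factorial i) else 0, ?_⟩
  rw [factorialPartialSum, Finset.sum_mul]
  push_cast
  refine Finset.sum_congr rfl fun i hi => ?_
  have hin : i ! ≤ n ! := Nat.factorial_le (Nat.lt_succ_iff.1 (Finset.mem_range.1 hi))
  by_cases hiS : i ∈ S
  · rw [Set.indicator_of_mem hiS, if_pos hiS, pow_sub₀ (2 : ℝ) two_ne_zero hin]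
    ring
  · rw [Set.indicator_of_notMem hiS, if_neg hiS, zero_mul]

open scoped Nat in
theorem factorialPartialSum_succ (S : Set ℕ) (n : ℕ) :
    factorialPartialSum S (n + 1) =
      factorialPartialSum S n + S.indicator (fun i => 1 / 2 ^ i !) (n + 1) :=
  Finset.sum_range_succ _ _

theorem tendsto_factorialPartialSum (S : Set ℕ) :
    Filter.Tendsto (factorialPartialSum S) Filter.atTop (nhds (factorialSum S)) :=
  (((LiouvilleNumber.summable one_lt_two).indicator S).hasSum.tendsto_sum_nat).comp
    (Filter.tendsto_add_atTop_nat 1)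

open scoped Nat in
open MvPolynomial in
/-- If each `S i` has infinitely many members outside any finitely many other `S j`, then the numbers
`factorialSum (S i)` are algebraically independent. -/
theorem algebraicIndependent_factorialSum {σ : Type*} {S : σ → Set ℕ}
    (hS : ∀ (F : Finset σ), ∀ i ∉ F, {n ∈ S i | ∀ j ∈ F, n ∉ S j}.Infinite) :
    AlgebraicIndependent ℚ fun i => factorialSum (S i) := by
  classical
  refine algebraicIndependent_of_aeval_pderiv_eq_zero fun p i hp => ?_
  obtain ⟨q, hq, hq0, hqδ⟩ := exists_continuous_aeval_update p i
  have hD : ∀ n : ℕ, 2 ≤ 2 ^ n ! := fun n =>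
    Nat.le_self_pow (Nat.factorial_ne_zero n) 2
  have hev : ∀ᶠ n in Filter.atTop, aeval (fun i => factorialPartialSum (S i) n) p = 0 :=
    eventually_aeval_eq_zero (u := fun n i => factorialPartialSum (S i) n) hD
      (fun n i => exists_factorialPartialSum_mul_eq_intCast (S i) n)
      (fun n i => abs_factorialPartialSum_sub_le (S i) n) hp
  have hfreq : ∃ᶠ n in Filter.atTop, n + 1 ∈ S i ∧ ∀ j ∈ p.vars.erase i, n + 1 ∉ S j := by
    rw [Filter.frequently_atTop]
    intro N
    obtain ⟨n, hn, hNn⟩ := (hS (p.vars.erase i) i (Finset.notMem_erase i _)).exists_gt N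
    exact ⟨n - 1, by omega, by rwa [Nat.sub_add_cancel (by omega)]⟩
  have hpow : Filter.Tendsto (fun n : ℕ => (1 : ℝ) / 2 ^ (n + 1)!) Filter.atTop (nhds 0) :=
    (LiouvilleNumber.summable one_lt_two).tendsto_atTop_zero.comp (Filter.tendsto_add_atTop_nat 1)
  have hlim : Filter.Tendsto (fun n : ℕ =>
      q (fun i => factorialPartialSum (S i) n, 1 / 2 ^ (n + 1)!)) Filter.atTop
      (nhds (q (fun i => factorialSum (S i), 0))) :=
    (hq.tendsto _).comp
      ((tendsto_pi_nhds.2 fun i => tendsto_factorialPartialSum (S i)).prodMk_nhds hpow)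
  rw [← hq0]
  refine isClosed_singleton.mem_of_frequently_of_tendsto (s := {(0 : ℝ)}) ?_ hlim
  refine (hfreq.and_eventually (hev.and ((Filter.tendsto_add_atTop_nat 1).eventually hev))).mono ?_
  rintro n ⟨⟨hni, hnj⟩, h0, h1⟩
  have hupd : aeval (fun i => factorialPartialSum (S i) (n + 1)) p =
      aeval (Function.update (fun i => factorialPartialSum (S i) n) i
        (factorialPartialSum (S i) n + 1 / 2 ^ (n + 1)!)) p := by
    refine eval₂Hom_congr' rfl (fun j hj _ => ?_) rfl
    by_cases hji : j = i
    · subst hji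
      rw [Function.update_self, factorialPartialSum_succ, Set.indicator_of_mem hni]
    · rw [Function.update_of_ne hji, factorialPartialSum_succ,
        Set.indicator_of_notMem (hnj j (Finset.mem_erase.2 ⟨hji, hj⟩)), add_zero]
  rw [hupd, hqδ (fun i => factorialPartialSum (S i) n), h0, zero_add] at h1
  exact (mul_eq_zero.1 h1).resolve_left (by positivity)

/-- The number whose binary digits are `1` followed by the first `k` digits of `A`. -/
def branchCode (A : ℕ → Bool) : ℕ → ℕ
  | 0 => 1
  | k + 1 => 2 * branchCode A k + (A k).toNat

theorem lt_branchCode (A : ℕ → Bool) (k : ℕ) : k < branchCode A k := by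
  induction k with
  | zero => exact one_pos
  | succ k ih =>
    rw [branchCode]
    omega

theorem branchCode_eq_branchCode {A B : ℕ → Bool} :
    ∀ {k l : ℕ}, branchCode A k = branchCode B l → k = l ∧ ∀ i < k, A i = B i
  | 0, 0, _ => ⟨rfl, fun _ h => absurd h (Nat.not_lt_zero _)⟩
  | 0, l + 1, h => by
    have := lt_branchCode B l
    simp only [branchCode] at h
    omega
  | k + 1, 0, h => by
    have := lt_branchCode A k
    simp only [branchCode] at h
    omega
  | k + 1, l + 1, h => by
    simp only [branchCode] at h
    have ha := Bool.toNat_lt (A k)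
    have hb := Bool.toNat_lt (B l)
    obtain ⟨rfl, hi⟩ := branchCode_eq_branchCode (show branchCode A k = branchCode B l by omega)
    refine ⟨rfl, fun i hik => ?_⟩
    rcases Nat.lt_succ_iff_lt_or_eq.1 hik with hik | rfl
    · exact hi i hik
    · have hAB : (A i).toNat = (B i).toNat := by omega
      revert hAB
      cases A i <;> cases B i <;> simp

theorem continuous_branchCode (k : ℕ) : Continuous fun A => branchCode A k := by
  induction k with
  | zero => exact continuous_const
  | succ k ih =>
    exact (continuous_const.mul ih).add
      ((continuous_of_discreteTopology (f := Bool.toNat)).comp (continuous_apply k))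

theorem isClopen_setOf_mem_range_branchCode (n : ℕ) :
    IsClopen {A | n ∈ Set.range (branchCode A)} := by
  have : {A | n ∈ Set.range (branchCode A)} =
      ⋃ k ∈ Finset.range n, (fun A => branchCode A k) ⁻¹' {n} := by
    ext A
    simp only [Set.mem_ofPred_eq, Set.mem_range, Set.mem_iUnion, Finset.mem_range,
      Set.mem_preimage, Set.mem_singleton_iff, exists_prop]
    exact ⟨fun ⟨k, hk⟩ => ⟨k, hk ▸ lt_branchCode A k, hk⟩, fun ⟨k, _, hk⟩ => ⟨k, hk⟩⟩
  rw [this]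
  exact isClopen_biUnion_finset fun k _ => (isClopen_discrete _).preimage (continuous_branchCode k)

/-- A real number attached to each point of the Cantor space, giving an algebraically independent
Cantor set. -/
def branchReal (A : ℕ → Bool) : ℝ :=
  factorialSum (Set.range (branchCode A))

theorem continuous_branchReal : Continuous branchReal := by
  refine continuous_tsum (fun n => ?_) (LiouvilleNumber.summable one_lt_two) fun n A => ?_
  · exact (isClopen_setOf_mem_range_branchCode n).continuous_indicator
      (continuous_const (y := (1 : ℝ) / 2 ^ n.factorial))
  · rw [Real.norm_of_nonneg (Set.indicator_nonneg (fun _ _ => by positivity) _)]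
    exact Set.indicator_le_self' (fun _ _ => by positivity) _

theorem algebraicIndependent_branchReal : AlgebraicIndependent ℚ branchReal := by
  refine algebraicIndependent_factorialSum fun F A hA => ?_
  have hsep : ∀ᶠ k in Filter.atTop, ∀ B ∈ F, ∃ i < k, A i ≠ B i := by
    rw [Filter.eventually_all_finset]
    intro B hB
    obtain ⟨i, hi⟩ := Function.ne_iff.1 (fun h : A = B => hA (h ▸ hB))
    filter_upwards [Filter.eventually_gt_atTop i] with k hk using ⟨i, hk, hi⟩
  obtain ⟨K, hK⟩ := Filter.eventually_atTop.1 hsep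
  refine ((Set.Ici_infinite K).image (f := branchCode A)
    fun k _ l _ h => (branchCode_eq_branchCode h).1).mono ?_
  rintro _ ⟨k, hk, rfl⟩
  refine ⟨⟨k, rfl⟩, fun B hB => ?_⟩
  rintro ⟨l, hl⟩
  obtain ⟨i, hi, hne⟩ := hK k hk B hB
  exact hne ((branchCode_eq_branchCode hl.symm).2 i hi)

theorem injective_branchReal : Function.Injective branchReal :=
  algebraicIndependent_branchReal.injective

theorem isCantorSet_range {f : (ℕ → Bool) → ℝ} (hf : Continuous f) (hinj : Function.Injective f) :
    IsCantorSet (Set.range f) := by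
  refine ⟨Set.range_nonempty f, isCompact_range hf,
    (hf.isClosedEmbedding hinj).isEmbedding.isTotallyDisconnected_range.2 inferInstance, ?_⟩
  rintro _ ⟨A, rfl⟩
  rw [accPt_iff_frequently]
  have hlim : Filter.Tendsto (fun n => Function.update A n (!A n)) Filter.atTop (nhds A) := by
    refine tendsto_pi_nhds.2 fun i => tendsto_const_nhds.congr' ?_
    filter_upwards [Filter.eventually_gt_atTop i] with n hn
    rw [Function.update_of_ne hn.ne]
  refine ((hf.tendsto A).comp hlim).frequently (Filter.Frequently.of_forall fun n => ⟨?_, ⟨_, rfl⟩⟩)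
  intro h
  have := congrFun (hinj h) n
  simp at this

theorem isCantorSet_image_branchReal (b : Bool) : IsCantorSet (branchReal '' {A | A 0 = b}) := by
  have himage : branchReal '' {A | A 0 = b} =
      Set.range fun A : ℕ → Bool => branchReal (fun n => n.casesOn b A) := by
    ext y
    constructor
    · rintro ⟨A, hA, rfl⟩
      refine ⟨fun n => A (n + 1), congrArg branchReal (funext fun n => ?_)⟩
      cases n
      exacts [hA.symm, rfl]
    · rintro ⟨A, rfl⟩
      exact ⟨_, rfl, rfl⟩
  rw [himage]
  refine isCantorSet_range (continuous_branchReal.comp (continuous_pi fun n => ?_)) ?_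
  · cases n
    exacts [continuous_const, continuous_apply _]
  · intro A B h
    exact funext fun n => congrFun (injective_branchReal h) (n + 1)

/-- A family indexed by a linear order is algebraically independent if each member is transcendental
over the previous ones. -/
theorem algebraicIndependent_of_transcendental_adjoin_Iio {R A J : Type*} [CommRing R]
    [CommRing A] [Algebra R A] [LinearOrder J] (hinj : Function.Injective (algebraMap R A))
    {t : J → A} (h : ∀ j, Transcendental (Algebra.adjoin R (t '' Set.Iio j)) (t j)) :
    AlgebraicIndependent R t := by
  refine algebraicIndependent_of_finite_type fun s hs => ?_
  lift s to Finset J using hs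
  change AlgebraicIndepOn R t (s : Set J)
  induction s using Finset.induction_on_max with
  | empty =>
    rw [Finset.coe_empty]
    exact algebraicIndependent_empty_type_iff.2 hinj
  | insert a s hs ih =>
    rw [Finset.coe_insert]
    refine ih.insert fun halg => h a ?_
    have hle : Algebra.adjoin R (t '' (s : Set J)) ≤ Algebra.adjoin R (t '' Set.Iio a) :=
      Algebra.adjoin_mono (Set.image_mono fun x hx => hs x hx)
    obtain ⟨p, hp0, hp⟩ := halg
    refine ⟨p.map (Subalgebra.inclusion hle).toRingHom, ?_, ?_⟩
    · exact (Polynomial.map_ne_zero_iff (Subalgebra.inclusion_injective hle)).2 hp0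
    · rw [Polynomial.aeval_def, Polynomial.eval₂_map]
      exact hp

theorem mk_isAlgebraic_adjoin_lt_continuum {s : Set ℝ} (hs : #s < 𝔠) :
    #{x : ℝ // IsAlgebraic (Algebra.adjoin ℚ s) x} < 𝔠 := by
  refine (Algebraic.cardinalMk_le_max _ _).trans_lt (max_lt ?_ aleph0_lt_continuum)
  refine (Algebra.cardinalMk_adjoin_le ℚ s).trans_lt (max_lt (max_lt ?_ hs) aleph0_lt_continuum)
  exact Cardinal.mk_le_aleph0.trans_lt aleph0_lt_continuum

/-- Transfinite choice of an algebraically independent system of representatives. -/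
theorem exists_algebraicIndependent_mem {J : Type} (hJ : #J ≤ 𝔠) {P : J → Set ℝ}
    (hP : ∀ j, #(P j) = 𝔠) : ∃ t : J → ℝ, AlgebraicIndependent ℚ t ∧ ∀ j, t j ∈ P j := by
  obtain ⟨_, _, hord⟩ := exists_ord_eq_type_lt J
  have hex : ∀ (j : J) (f : Set.Iio j → ℝ),
      ∃ x ∈ P j, Transcendental (Algebra.adjoin ℚ (Set.range f)) x := by
    intro j f
    by_contra! hcon
    have hlt := mk_isAlgebraic_adjoin_lt_continuum (s := Set.range f)
      (mk_range_le.trans_lt ((mk_Iio_lt j hord).trans_le hJ))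
    refine hlt.not_ge ((hP j).symm.trans_le (mk_le_mk_of_subset fun x hx => ?_))
    exact not_not.1 (hcon x hx)
  choose g hgP hg using hex
  let t : J → ℝ := WellFounded.fix (wellFounded_lt (α := J)) fun j ih => g j fun k => ih k k.2
  have ht : ∀ j, t j = g j fun k => t k := fun j => WellFounded.fix_eq _ _ j
  refine ⟨t, algebraicIndependent_of_transcendental_adjoin_Iio (algebraMap ℚ ℝ).injective
    fun j => ?_, fun j => ?_⟩
  · rw [ht j, Set.image_eq_range]
    exact hg j _
  · rw [ht j]
    exact hgP j _

theorem IsCantorSet.mk_eq {C : Set ℝ} (hC : IsCantorSet C) : #C = 𝔠 := by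
  refine le_antisymm ((mk_set_le C).trans_eq mk_real) ?_
  obtain ⟨f, hf, -, hinj⟩ := Perfect.exists_nat_bool_injection ⟨hC.2.1.isClosed, hC.2.2.2⟩ hC.1
  have h := mk_le_of_injective (f := fun A => (⟨f A, hf ⟨A, rfl⟩⟩ : C))
    fun A B h => hinj (congrArg Subtype.val h)
  simpa using h

theorem mk_setOf_isCantorSet_le : #{C : Set ℝ // IsCantorSet C} ≤ 𝔠 := by
  let s : Set (Set ℝ) := ⋃ a : ℚ, {Set.Iio (a : ℝ)}
  have hs : #s ≤ 𝔠 := (Set.countable_iUnion fun a => Set.countable_singleton _).le_aleph0.trans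
    aleph0_le_continuum
  refine le_trans (mk_le_mk_of_subset fun C hC => ?_)
    (MeasurableSpace.cardinal_measurableSet_le_continuum hs)
  have := hC.2.1.isClosed.measurableSet
  rw [BorelSpace.measurable_eq (α := ℝ), Real.borel_eq_generateFrom_Iio_rat] at this
  exact this

theorem AlgebraicIndependent.option_ne {R A J : Type*} [CommRing R] [CommRing A] [Algebra R A]
    {t : J → A} (h : AlgebraicIndependent R t) (j₀ : J) :
    AlgebraicIndependent R (fun o : Option {j // j ≠ j₀} => o.elim (t j₀) fun j => t j) := by
  have hinj : Function.Injective fun o : Option {j // j ≠ j₀} => o.elim j₀ Subtype.val := by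
    rintro (_ | a) (_ | b) h
    exacts [rfl, absurd h.symm b.2, absurd h a.2, congrArg some (Subtype.ext h)]
  convert! h.comp _ hinj using 2 with o
  cases o <;> rfl

theorem exists_bernstein_family {C₀ : Set ℝ} (hC₀ : IsCantorSet C₀) :
    ∃ (B : Set (Subfield ℝ)) (τ σ : ℝ), #B = 2 ^ 𝔠 ∧ (∀ K ∈ B, IsMaximalOmitting K τ) ∧
      (∀ K ∈ B, IsBernsteinField K) ∧ (∀ K ∈ B, ∀ L ∈ B, K ≤ L → K = L) ∧
      σ ∈ C₀ ∧ ∀ K ∈ B, σ ∈ K := by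
  let J := {C : Set ℝ // IsCantorSet C} × ℝ
  have hJ : #J ≤ 𝔠 := by
    rw [mk_prod, lift_id, lift_id, mk_real]
    exact (mul_le_mul_left mk_setOf_isCantorSet_le _).trans_eq continuum_mul_self
  obtain ⟨t, ht, htmem⟩ := exists_algebraicIndependent_mem hJ (P := fun j => j.1.1)
    fun j => j.1.2.mk_eq
  let j₀ : J := (⟨C₀, hC₀⟩, 2)
  obtain ⟨K, hK, hKmem, hKle⟩ := exists_family_isMaximalOmitting (ι := {j // j ≠ j₀}) (τ := t j₀)
    (t := fun j => t j) (ht.option_ne j₀)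
  let R : Set ℝ → Set {j // j ≠ j₀} := fun T => {i | i.1.2 = 1 ∨ i.1.1.1 = C₀ ∧ i.1.2 ∈ T}
  have hR : Set.InjOn R (𝒫 Set.Ioi 2) := by
    have key : ∀ T ∈ 𝒫 Set.Ioi (2 : ℝ), ∀ T' ∈ 𝒫 Set.Ioi (2 : ℝ), R T = R T' → T ⊆ T' := by
      intro T hT T' _ h r hr
      have h2r : 2 < r := hT hr
      have hne : ((⟨C₀, hC₀⟩, r) : J) ≠ j₀ := fun h => h2r.ne' (congrArg Prod.snd h)
      have hmem : (⟨_, hne⟩ : {j // j ≠ j₀}) ∈ R T := Or.inr ⟨rfl, hr⟩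
      rw [h] at hmem
      exact (hmem.resolve_left fun h1 => by simp only at h1; linarith).2
    exact fun T hT T' hT' h => (key T hT T' hT' h).antisymm (key T' hT' T hT h.symm)
  have hzero : ∀ T ∈ 𝒫 Set.Ioi (2 : ℝ), ∀ C, t (C, 0) ∈ K (R T) := by
    intro T hT C
    have hne : ((C, 0) : J) ≠ j₀ := fun h => two_ne_zero (congrArg Prod.snd h).symm
    refine (hKmem (R T) ⟨_, hne⟩).2 ?_
    rintro (h | ⟨-, h⟩)
    · exact zero_ne_one h
    · exact absurd (hT h) (by norm_num)
  have hone : ∀ T, ∀ C, t (C, 1) ∉ K (R T) := by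
    intro T C
    have hne : ((C, 1) : J) ≠ j₀ := fun h => by
      have : (1 : ℝ) = 2 := congrArg Prod.snd h
      norm_num at this
    exact fun h => (hKmem (R T) ⟨_, hne⟩).1 h (Or.inl rfl)
  refine ⟨(fun T => K (R T)) '' 𝒫 Set.Ioi 2, t j₀, t (⟨C₀, hC₀⟩, 0), ?_, ?_, ?_, ?_,
    htmem (⟨C₀, hC₀⟩, 0), ?_⟩
  · rw [mk_image_eq_of_injOn _ _ fun T hT T' hT' h => hR hT hT' (hKle _ _ (le_of_eq h)),
      mk_powerset, mk_Ioi_real]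
  · rintro _ ⟨T, -, rfl⟩
    exact hK _
  · rintro _ ⟨T, hT, rfl⟩
    refine ⟨fun ⟨C, hCK, hC⟩ => ?_, fun ⟨C, hCK, hC⟩ => ?_⟩
    · exact hone T ⟨C, hC⟩ (hCK (htmem (⟨C, hC⟩, 1)))
    · exact hCK (htmem (⟨C, hC⟩, 0)) (hzero T hT ⟨C, hC⟩)
  · rintro _ ⟨T, -, rfl⟩ _ ⟨T', -, rfl⟩ h
    exact congrArg K (hKle _ _ h)
  · rintro _ ⟨T, hT, rfl⟩
    exact hzero T hT _

theorem mk_setOf_zero_eq_true_and_ne (A₀ : ℕ → Bool) :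
    #{A : ℕ → Bool | A 0 = true ∧ A ≠ A₀} = 𝔠 := by
  refine le_antisymm ((mk_set_le _).trans (by simp)) ?_
  let f : (ℕ → Bool) → ℕ → Bool := fun B n =>
    n.casesOn true fun n => n.casesOn (!A₀ 1) B
  have hf : ∀ B, f B 0 = true ∧ f B ≠ A₀ := fun B => ⟨rfl, fun h => by
    have h1 : (!A₀ 1) = A₀ 1 := congrFun h 1
    simp at h1⟩
  have h := mk_le_of_injective (f := fun B => (⟨f B, hf B⟩ : {A | A 0 = true ∧ A ≠ A₀}))
    fun B B' h => funext fun n => congrFun (congrArg Subtype.val h) (n + 2)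
  rwa [← power_def, mk_nat, mk_bool, two_power_aleph0] at h

theorem exists_cantor_family {A₀ : ℕ → Bool} (hA₀ : A₀ 0 = true) :
    ∃ C : Set (Subfield ℝ), #C = 2 ^ 𝔠 ∧ (∀ K ∈ C, IsMaximalOmitting K (branchReal A₀)) ∧
      (∀ K ∈ C, IsCantorField K) ∧ ∀ K ∈ C, ∀ L ∈ C, K ≤ L → K = L := by
  obtain ⟨K, hK, hKmem, hKle⟩ := exists_family_isMaximalOmitting (ι := {A // A ≠ A₀})
    (τ := branchReal A₀) (t := fun A => branchReal A) (algebraicIndependent_branchReal.option_ne A₀)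
  let Z : Set (ℕ → Bool) := {A | A 0 = true ∧ A ≠ A₀}
  refine ⟨(fun S => K (Subtype.val ⁻¹' S)) '' 𝒫 Z, ?_, ?_, ?_, ?_⟩
  · rw [mk_image_eq_of_injOn, mk_powerset, mk_setOf_zero_eq_true_and_ne]
    intro S hS S' hS' h
    have hSS' := hKle _ _ (le_of_eq h)
    have himage : ∀ T ∈ 𝒫 Z, Subtype.val '' (Subtype.val ⁻¹' T : Set {A // A ≠ A₀}) = T :=
      fun T hT => Set.image_preimage_eq_of_subset fun A hA => ⟨⟨A, (hT hA).2⟩, rfl⟩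
    rw [← himage S hS, hSS', himage S' hS']
  · rintro _ ⟨S, -, rfl⟩
    exact hK _
  · rintro _ ⟨S, hS, rfl⟩
    refine ⟨fun h => (hK _).notMem (h ▸ Subfield.mem_top _), _, ?_,
      isCantorSet_image_branchReal false⟩
    rintro _ ⟨A, hA, rfl⟩
    have hne : A ≠ A₀ := by
      rintro rfl
      exact Bool.false_ne_true (hA.symm.trans hA₀)
    exact (hKmem _ ⟨A, hne⟩).2 fun hAS => Bool.false_ne_true (hA.symm.trans (hS hAS).1)
  · rintro _ ⟨S, -, rfl⟩ _ ⟨S', -, rfl⟩ h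
    exact congrArg K (hKle _ _ h)

/-- Theorem 3: families 𝒞 of Cantor fields and ℬ of Bernstein fields, each of
size 2^𝔠, with all fields in 𝒞 ∪ ℬ pairwise incomparable and [ℝ : K] = ℵ₀
for every K ∈ 𝒞 ∪ ℬ. -/
theorem exists_large_cantor_bernstein_fields :
    ∃ C B : Set (Subfield ℝ),
      Cardinal.mk C = 2 ^ Cardinal.continuum ∧
      Cardinal.mk B = 2 ^ Cardinal.continuum ∧
      (∀ K ∈ C, IsCantorField K) ∧
      (∀ K ∈ B, IsBernsteinField K) ∧
      (∀ K ∈ C ∪ B, ∀ L ∈ C ∪ B, K ≠ L → IsEmpty (K →+* L)) ∧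
      (∀ K ∈ C ∪ B, Module.rank K ℝ = Cardinal.aleph0) := by
  obtain ⟨B, τ, _, hBcard, hBτ, hB, hBle, ⟨A₀, hA₀, rfl⟩, hBσ⟩ :=
    exists_bernstein_family (isCantorSet_image_branchReal true)
  obtain ⟨C, hCcard, hCσ, hC, hCle⟩ := exists_cantor_family hA₀
  have hmax : ∀ K ∈ C ∪ B, ∃ ρ, IsMaximalOmitting K ρ := by
    rintro K (hK | hK)
    exacts [⟨_, hCσ K hK⟩, ⟨_, hBτ K hK⟩]
  refine ⟨C, B, hCcard, hBcard, hC, hB, fun K hK L hL hne => ⟨fun φ => ?_⟩, fun K hK => ?_⟩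
  · obtain ⟨ρ, hρ⟩ := hmax K hK
    have hle : K ≤ L := Subfield.le_of_ringHom (fun a => hρ.sqrt_mem) φ
    rcases hK with hK | hK <;> rcases hL with hL | hL
    · exact hne (hCle K hK L hL hle)
    · obtain ⟨D, hDK, hD⟩ := (hC K hK).2
      exact (hB L hL).1 ⟨D, hDK.trans hle, hD⟩
    · exact (hCσ L hL).notMem (hle (hBσ K hK))
    · exact hne (hBle K hK L hL hle)
  · obtain ⟨ρ, hρ⟩ := hmax K hK
    exact hρ.rank_eq_aleph0
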